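/- Let R be a ring and X ⊆ R an approximate subring. Then there exists an approximate subring Y ⊆ 4X + X·4X which is commensurable with X and is closed under multiplication, i.e. Y·Y ⊆ Y. -/

import Mathlib

open Pointwise

universe u

/-- A subset of a ring is additively symmetric if it contains `0` and equals its negation. -/
def AddSymm {R : Type u} [NonUnitalRing R] (X : Set R) : Prop :=
  (0 : R) ∈ X ∧ X = -X

/-- `X` is an approximate subring: it is additively symmetric and `X·X ∪ (X+X)` is covered by
finitely many additive translates of `X`. -/
def IsApproxSubring {R : Type u} [NonUnitalRing R] (X : Set R) : Prop :=
  AddSymm X ∧ ∃ F : Set R, F.Finite ∧ (X * X) ∪ (X + X) ⊆ F + X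

/-- `A` and `B` are commensurable: each is covered by finitely many additive translates
of the other. -/
def CommensurableSets {R : Type u} [NonUnitalRing R] (A B : Set R) : Prop :=
  (∃ F : Set R, F.Finite ∧ A ⊆ F + B) ∧ (∃ G : Set R, G.Finite ∧ B ⊆ G + A)

/-- `A` is covered by finitely many translates of `B`. -/
def Cov {R : Type u} [NonUnitalRing R] (A B : Set R) : Prop :=
  ∃ F : Set R, F.Finite ∧ A ⊆ F + B

namespace Cov
variable {R : Type u} [NonUnitalRing R] {A B C D : Set R}

theorem mono (h : A ⊆ B) (h' : Cov B C) : Cov A C := by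
  obtain ⟨F, hF, h1⟩ := h'
  exact ⟨F, hF, h.trans h1⟩

theorem trans (h : Cov A B) (h' : Cov B C) : Cov A C := by
  obtain ⟨F, hF, h1⟩ := h
  obtain ⟨G, hG, h2⟩ := h'
  refine ⟨F + G, hF.add hG, h1.trans ?_⟩
  rw [add_assoc]
  exact Set.add_subset_add_left h2

theorem add (h : Cov A B) (h' : Cov C D) : Cov (A + C) (B + D) := by
  obtain ⟨F, hF, h1⟩ := h
  obtain ⟨G, hG, h2⟩ := h'
  refine ⟨F + G, hF.add hG, (Set.add_subset_add h1 h2).trans ?_⟩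
  rw [add_add_add_comm]

theorem restrict (h : Cov A B) : ∃ F : Set R, F.Finite ∧ A ⊆ F + B ∧
    ∀ f ∈ F, ∃ a ∈ A, ∃ b ∈ B, f = a - b := by
  obtain ⟨F, hF, h1⟩ := h
  refine ⟨{f ∈ F | ∃ a ∈ A, ∃ b ∈ B, f = a - b}, hF.subset (fun _ h => h.1), ?_, fun f h => h.2⟩
  intro a ha
  obtain ⟨f, hf, b, hb, rfl⟩ := h1 ha
  exact ⟨f, ⟨hf, _, ha, b, hb, by simp⟩, b, hb, rfl⟩

theorem generic {X : Set R} (hs : ∀ x ∈ X, -x ∈ X) {ι : Type u} [Finite ι] (φ : ι → R →+ R)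
    (h : ∀ i, Cov (φ i '' X) X) : Cov X {w | w ∈ X + X ∧ ∀ i, φ i w ∈ X + X} := by
  choose G hG hc using h
  have h1 : ∀ x : X, ∃ c : ι → R, ∀ i, c i ∈ G i ∧ ∃ y ∈ X, φ i x = c i + y := by
    intro x
    have : ∀ i, ∃ c, c ∈ G i ∧ ∃ y ∈ X, φ i x = c + y := by
      intro i
      obtain ⟨c, hc, y, hy, e⟩ := hc i ⟨x, x.2, rfl⟩
      exact ⟨c, hc, y, hy, e.symm⟩
    choose c hc using this
    exact ⟨c, hc⟩
  choose c hc using h1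
  have hfin : (Set.range c).Finite := by
    refine (Set.Finite.pi (t := G) hG).subset ?_
    rintro _ ⟨x, rfl⟩ i _
    exact (hc x i).1
  have h2 : ∀ t : Set.range c, ∃ x : X, c x = t := fun t => t.2
  choose r hr using h2
  have : Finite (Set.range c) := hfin
  refine ⟨Set.range (fun t => (r t : R)), Set.finite_range _, ?_⟩
  intro x hx
  let t : Set.range c := ⟨c ⟨x, hx⟩, ⟨_, rfl⟩⟩
  refine ⟨r t, ⟨t, rfl⟩, x - r t, ⟨?_, ?_⟩, by simp⟩
  · exact ⟨x, hx, -(r t : R), hs _ (r t).2, by simp [sub_eq_add_neg]⟩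
  · intro i
    obtain ⟨_, y, hy, e⟩ := hc ⟨x, hx⟩ i
    obtain ⟨_, z, hz, e'⟩ := hc (r t) i
    refine ⟨y, hy, -z, hs _ hz, ?_⟩
    have := hr t
    rw [map_sub, e', this]
    simp only at e
    rw [e]
    simp only [t]
    abel

end Cov

/-- Every approximate subring `X` is commensurable with an approximate subring
`Y ⊆ 4X + X·4X` which is closed under multiplication. -/
theorem stmt12 {R : Type u} [NonUnitalRing R] (X : Set R) (hX : IsApproxSubring X) :
    ∃ Y : Set R,
      Y ⊆ (X + X + X + X) + X * (X + X + X + X) ∧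
      IsApproxSubring Y ∧
      CommensurableSets Y X ∧
      Y * Y ⊆ Y := by
  obtain ⟨⟨h0, hneg⟩, F1, hF1, hsub⟩ := hX
  have hs : ∀ x ∈ X, -x ∈ X := by
    intro x hx
    rw [hneg]; simpa using hx
  have cm : Cov (X * X) X := ⟨F1, hF1, Set.subset_union_left.trans hsub⟩
  have ca : Cov (X + X) X := ⟨F1, hF1, Set.subset_union_right.trans hsub⟩
  have add2 : ∀ {A B : Set R}, Cov A X → Cov B X → Cov (A + B) X :=
    fun h h' => (h.add h').trans ca
  have c1 : Cov X X := ⟨{0}, Set.finite_singleton 0, fun x hx => ⟨0, rfl, x, hx, by simp⟩⟩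
  have hs2 : ∀ x ∈ X + X, -x ∈ X + X := by
    rintro _ ⟨a, ha, b, hb, rfl⟩
    exact ⟨-a, hs a ha, -b, hs b hb, by simp only; abel⟩
  have h02 : (0 : R) ∈ X + X := ⟨0, h0, 0, h0, by simp⟩
  -- left multiplication
  have L1 : ∀ f ∈ X, Cov ((fun x => f * x) '' X) X := by
    intro f hf
    refine Cov.mono ?_ cm
    rintro _ ⟨x, hx, rfl⟩
    exact ⟨f, hf, x, hx, rfl⟩
  have L2 : ∀ f g : R, Cov ((fun x => f * x) '' X) X → Cov ((fun x => g * x) '' X) X →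
      Cov ((fun x => (f + g) * x) '' X) X := by
    intro f g hf hg
    refine Cov.mono ?_ (add2 hf hg)
    rintro _ ⟨x, hx, rfl⟩
    exact ⟨f * x, ⟨x, hx, rfl⟩, g * x, ⟨x, hx, rfl⟩, (add_mul _ _ _).symm⟩
  -- right multiplication
  have R1 : ∀ f ∈ X, Cov ((fun x => x * f) '' X) X := by
    intro f hf
    refine Cov.mono ?_ cm
    rintro _ ⟨x, hx, rfl⟩
    exact ⟨x, hx, f, hf, rfl⟩
  have R2 : ∀ f g : R, Cov ((fun x => x * f) '' X) X → Cov ((fun x => x * g) '' X) X →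
      Cov ((fun x => x * (f + g)) '' X) X := by
    intro f g hf hg
    refine Cov.mono ?_ (add2 hf hg)
    rintro _ ⟨x, hx, rfl⟩
    exact ⟨x * f, ⟨x, hx, rfl⟩, x * g, ⟨x, hx, rfl⟩, (mul_add _ _ _).symm⟩
  have R3 : ∀ f g : R, Cov ((fun x => x * f) '' X) X → Cov ((fun x => x * g) '' X) X →
      Cov ((fun x => x * (f * g)) '' X) X := by
    intro f g hf hg
    obtain ⟨F, hF, h⟩ := hf
    refine Cov.trans (B := (fun x => x * g) '' X) ⟨(fun x => x * g) '' F, hF.image _, ?_⟩ hg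
    rintro _ ⟨x, hx, rfl⟩
    obtain ⟨a, ha, y, hy, e⟩ := h ⟨x, hx, rfl⟩
    refine ⟨a * g, ⟨a, ha, rfl⟩, y * g, ⟨y, hy, rfl⟩, ?_⟩
    simp only at e ⊢
    rw [← add_mul, e, mul_assoc]
  -- first choice
  obtain ⟨F0, hF0, hF0c, hF0m⟩ := ca.restrict
  have : Finite F0 := hF0
  have cW := Cov.generic hs (fun f : F0 => AddMonoidHom.mulLeft (f : R)) (by
    rintro ⟨f, hf⟩
    obtain ⟨_, ⟨a, ha, b, hb, rfl⟩, c, hc, rfl⟩ := hF0m f hf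
    have := L2 _ _ (L2 _ _ (L1 a ha) (L1 b hb)) (L1 _ (hs c hc))
    rw [← sub_eq_add_neg] at this
    exact this)
  set W : Set R := {w | w ∈ X + X ∧ ∀ i : F0, AddMonoidHom.mulLeft (i : R) w ∈ X + X} with hW
  set U : Set R := (X + X + X + X) + X * (X + X + X + X) with hU
  have cU : Cov U X := by
    have c4 := add2 (add2 ca c1) c1
    refine add2 c4 (Cov.mono ?_ (add2 (add2 (add2 cm cm) cm) cm))
    rintro _ ⟨x, hx, _, ⟨_, ⟨_, ⟨a, ha, b, hb, rfl⟩, c, hc, rfl⟩, d, hd, rfl⟩, rfl⟩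
    simp only [mul_add]
    exact Set.add_mem_add (Set.add_mem_add (Set.add_mem_add (Set.mul_mem_mul hx ha)
      (Set.mul_mem_mul hx hb)) (Set.mul_mem_mul hx hc)) (Set.mul_mem_mul hx hd)
  obtain ⟨F, hF, hFc, hFm⟩ := (cU.trans cW).restrict
  have : Finite F := hF
  have cV := Cov.generic hs (fun f : F => AddMonoidHom.mulRight (f : R)) (by
    rintro ⟨f, hf⟩
    obtain ⟨u, hu, w, hw, rfl⟩ := hFm f hf
    have key : Cov ((fun x => x * (u + -w)) '' X) X := by
      refine R2 _ _ ?_ ?_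
      · have h4 : ∀ z ∈ X + X + X + X, Cov ((fun x => x * z) '' X) X := by
          rintro _ ⟨_, ⟨_, ⟨a, ha, b, hb, rfl⟩, c, hc, rfl⟩, d, hd, rfl⟩
          exact R2 _ _ (R2 _ _ (R2 _ _ (R1 a ha) (R1 b hb)) (R1 c hc)) (R1 d hd)
        obtain ⟨a, ha, _, ⟨x, hx, b, hb, rfl⟩, rfl⟩ := hu
        exact R2 _ _ (h4 a ha) (R3 _ _ (R1 x hx) (h4 b hb))
      · obtain ⟨a, ha, b, hb, e⟩ := hs2 w hw.1
        rw [← e]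
        exact R2 _ _ (R1 a ha) (R1 b hb)
    rw [← sub_eq_add_neg] at key
    exact key)
  set V : Set R := {w | w ∈ X + X ∧ ∀ i : F, AddMonoidHom.mulRight (i : R) w ∈ X + X} with hV
  have hVneg : ∀ v ∈ V, -v ∈ V := by
    rintro v ⟨h1, h2⟩
    refine ⟨hs2 v h1, fun i => ?_⟩
    rw [map_neg]
    exact hs2 _ (h2 i)
  have hV0 : (0 : R) ∈ V := ⟨h02, fun i => by rw [map_zero]; exact h02⟩
  have h2U : ∀ a ∈ X + X, ∀ b ∈ X + X, ∀ x ∈ X, ∀ w ∈ X + X, a + b + x * w ∈ U := by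
    intro a ha b hb x hx w hw
    refine Set.add_mem_add ?_ (Set.mul_mem_mul hx ?_)
    · have := Set.add_mem_add ha hb
      rwa [← add_assoc] at this
    · have := Set.add_mem_add hw h02
      rwa [← add_assoc, add_zero] at this
  have hVU : ∀ v ∈ V, v ∈ U := by
    intro v hv
    have := h2U v hv.1 0 h02 0 h0 0 h02
    simpa using this
  have hVUU : ∀ v ∈ V, ∀ u ∈ U, v * u ∈ U := by
    intro v hv u hu
    obtain ⟨f, hf, w, hw, rfl⟩ := hFc hu
    obtain ⟨f0, hf0, x, hx, e⟩ := hF0c hv.1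
    have e' : f0 + x = v := e
    have := h2U (v * f) (hv.2 ⟨f, hf⟩) (f0 * w) (hw.2 ⟨f0, hf0⟩) x hx w hw.1
    rw [add_assoc, ← add_mul, e', ← mul_add] at this
    exact this
  let Y : Subsemigroup R := Subsemigroup.closure V
  have hVY : V ⊆ Y := Subsemigroup.subset_closure
  have hY : ∀ y ∈ Y, y ∈ U ∧ ∀ u ∈ U, y * u ∈ U := by
    intro y hy
    induction hy using Subsemigroup.closure_induction with
    | mem v hv => exact ⟨hVU v hv, hVUU v hv⟩
    | mul a b _ _ ha hb =>
      refine ⟨ha.2 _ hb.1, fun u hu => ?_⟩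
      rw [mul_assoc]
      exact ha.2 _ (hb.2 u hu)
  have hYneg : ∀ y ∈ Y, -y ∈ Y := by
    intro y hy
    induction hy using Subsemigroup.closure_induction with
    | mem v hv => exact hVY (hVneg v hv)
    | mul a b _ hb ha _ =>
      rw [← neg_mul]
      exact Y.mul_mem ha hb
  have hYU : (Y : Set R) ⊆ U := fun y hy => (hY y hy).1
  have hYY : (Y : Set R) * Y ⊆ Y := by
    rintro _ ⟨a, ha, b, hb, rfl⟩
    exact Y.mul_mem ha hb
  have cXY : Cov X (Y : Set R) := by
    obtain ⟨G, hG, h⟩ := cV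
    exact ⟨G, hG, h.trans (Set.add_subset_add_left hVY)⟩
  have cYX : Cov (Y : Set R) X := Cov.mono hYU cU
  refine ⟨Y, hYU, ⟨⟨hVY hV0, ?_⟩, ?_⟩, ⟨cYX, cXY⟩, hYY⟩
  · ext y
    exact ⟨fun h => hYneg y h, fun h => by simpa using hYneg _ h⟩
  · obtain ⟨G, hG, h⟩ := (add2 cYX cYX).trans cXY
    refine ⟨G ∪ {0}, hG.union (Set.finite_singleton 0), Set.union_subset ?_ ?_⟩
    · intro y hy
      exact ⟨0, Or.inr rfl, y, hYY hy, by simp⟩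
    · exact h.trans (Set.add_subset_add_right Set.subset_union_left)
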